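/- (Anisotropic monotonicity of the isoperimetric quotient) Let Ω, K ⊂ ℝⁿ be convex bodies with nonempty interior, r = r(Ω,K), and define Q(λ) := V_n(Ω ∼ λK) / Per_K(Ω ∼ λK)^{n/(n−1)} for λ ∈ [0, r). Then Q is non-increasing on [0, r): for all 0 ≤ λ ≤ μ < r, Q(μ) ≤ Q(λ). -/

import Mathlib

open Pointwise MeasureTheory Set

noncomputable section

/-- The inner parallel body `Ω ∼ λK = {x : x + λK ⊆ Ω}`. -/
def innerPar {n : ℕ} (Ω K : Set (EuclideanSpace ℝ (Fin n))) (l : ℝ) :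
    Set (EuclideanSpace ℝ (Fin n)) :=
  {x | ∀ y ∈ K, x + l • y ∈ Ω}

/-- The inradius of `Ω` relative to `K`. -/
def inrad {n : ℕ} (Ω K : Set (EuclideanSpace ℝ (Fin n))) : ℝ :=
  sSup {l : ℝ | 0 ≤ l ∧ ∃ x, ∀ y ∈ K, x + l • y ∈ Ω}

/-- The anisotropic perimeter of `C` relative to `K`, realized as the anisotropic
Minkowski content `d/dt V_n(C + tK) |_{t=0⁺}`. -/
def aniPer {n : ℕ} (C K : Set (EuclideanSpace ℝ (Fin n))) : ℝ :=
  derivWithin (fun t : ℝ => (volume (C + t • K)).toReal) (Set.Ici (0:ℝ)) 0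

/-- The mixed volume `V(C,…,C,K,…,K)` with `i` copies of `K`, extracted as the
`i`-th Taylor coefficient (over `binom n i`) of `t ↦ V_n(C + tK)` at `t = 0⁺`. -/
def mixedVol {n : ℕ} (i : ℕ) (C K : Set (EuclideanSpace ℝ (Fin n))) : ℝ :=
  iteratedDerivWithin i (fun t : ℝ => (volume (C + t • K)).toReal) (Set.Ici (0:ℝ)) 0
    / (n.choose i * i.factorial)

lemma Real.volume_add_le_of_isCompact {A B C : Set ℝ} (hA : IsCompact A) (hB : IsCompact B)
    (hA' : A.Nonempty) (hB' : B.Nonempty) (h : A + B ⊆ C) :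
    volume A + volume B ≤ volume C := by
  obtain ⟨a, haA, ha⟩ := hA.exists_isGreatest hA'
  obtain ⟨b, hbB, hb⟩ := hB.exists_isLeast hB'
  have h₁ : volume A = volume ((fun x ↦ x + b) '' A) := by simp
  have h₂ : volume B = volume ((fun x ↦ a + x) '' B) := by simp
  have hdisj : AEDisjoint volume ((fun x ↦ x + b) '' A) ((fun x ↦ a + x) '' B) := by
    refine measure_mono_null (t := {a + b}) ?_ (by simp)
    rintro _ ⟨⟨x, hx, rfl⟩, ⟨y, hy, hxy⟩⟩
    have := ha hx
    have := hb hy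
    simp only [mem_singleton_iff] at *
    linarith
  rw [h₁, h₂, ← measure_union₀ ((hB.image (by fun_prop)).measurableSet.nullMeasurableSet) hdisj]
  refine measure_mono (union_subset ?_ ?_)
  · rintro _ ⟨x, hx, rfl⟩
    exact h (add_mem_add hx hbB)
  · rintro _ ⟨x, hx, rfl⟩
    exact h (add_mem_add haA hx)

lemma Real.volume_add_le {A B C : Set ℝ} (hA : MeasurableSet A) (hB : MeasurableSet B)
    (hA' : A.Nonempty) (hB' : B.Nonempty) (h : A + B ⊆ C) :
    volume A + volume B ≤ volume C := by
  have key : ∀ {A : Set ℝ}, MeasurableSet A →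
      volume A = ⨆ L : {L : Set ℝ // L ⊆ A ∧ IsCompact L ∧ L.Nonempty}, volume L.1 := by
    intro A hA
    refine le_antisymm (le_of_forall_lt fun r hr ↦ ?_) (iSup_le fun L ↦ measure_mono L.2.1)
    obtain ⟨L, hL, hLc, hLr⟩ := hA.exists_lt_isCompact hr
    exact hLr.trans_le (le_iSup (fun L : {L : Set ℝ // L ⊆ A ∧ IsCompact L ∧ L.Nonempty} ↦
      volume L.1) ⟨L, hL, hLc, nonempty_of_measure_ne_zero (ne_bot_of_gt hLr)⟩)
  have hne : ∀ {A : Set ℝ}, A.Nonempty →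
      Nonempty {L : Set ℝ // L ⊆ A ∧ IsCompact L ∧ L.Nonempty} := fun ⟨a, ha⟩ ↦
    ⟨{a}, by simpa, isCompact_singleton, singleton_nonempty a⟩
  have := hne hA'
  have := hne hB'
  rw [key hA, key hB]
  refine ENNReal.iSup_add_iSup_le fun L M ↦ ?_
  exact Real.volume_add_le_of_isCompact L.2.2.1 M.2.2.1 L.2.2.2 M.2.2.2
    ((add_subset_add L.2.1 M.2.1).trans h)

lemma ENNReal.geom_mean_le_arith_mean2 {s t : ℝ} (hs : 0 < s) (ht : 0 < t) (hst : s + t = 1)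
    (a b : ENNReal) : a ^ s * b ^ t ≤ ENNReal.ofReal s * a + ENNReal.ofReal t * b := by
  rcases eq_or_ne a ⊤ with rfl | ha
  · simp [ENNReal.mul_top, hs]
  rcases eq_or_ne b ⊤ with rfl | hb
  · simp [ENNReal.mul_top, ht]
  lift a to NNReal using ha
  lift b to NNReal using hb
  have := NNReal.geom_mean_le_arith_mean2_weighted ⟨s, hs.le⟩ ⟨t, ht.le⟩ a b (NNReal.eq hst)
  rw [← ENNReal.coe_rpow_of_nonneg _ hs.le, ← ENNReal.coe_rpow_of_nonneg _ ht.le,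
    ENNReal.ofReal_eq_coe_nnreal hs.le, ENNReal.ofReal_eq_coe_nnreal ht.le]
  exact_mod_cast this

/-- The one-dimensional Prékopa–Leindler inequality for functions with supremum one. -/
lemma lintegral_le_of_normalized {s t : ℝ} (hs : 0 < s) (ht : 0 < t) (hst : s + t = 1)
    {f g h : ℝ → ℝ} (hf : Measurable f) (hg : Measurable g) (hh : Measurable h)
    (hf0 : ∀ x, 0 ≤ f x) (hg0 : ∀ x, 0 ≤ g x) (hh0 : ∀ x, 0 ≤ h x)
    (hf1 : ∀ x, f x ≤ 1) (hg1 : ∀ x, g x ≤ 1)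
    (hf2 : ∀ r < 1, ∃ x, r < f x) (hg2 : ∀ r < 1, ∃ x, r < g x)
    (hfgh : ∀ x y, f x ^ s * g y ^ t ≤ h (s * x + t * y)) :
    ENNReal.ofReal s * (∫⁻ x, ENNReal.ofReal (f x)) + ENNReal.ofReal t * (∫⁻ x, ENNReal.ofReal (g x))
      ≤ ∫⁻ x, ENNReal.ofReal (h x) := by
  rw [lintegral_eq_lintegral_meas_lt _ (.of_forall hf0) hf.aemeasurable,
    lintegral_eq_lintegral_meas_lt _ (.of_forall hg0) hg.aemeasurable,
    lintegral_eq_lintegral_meas_lt _ (.of_forall hh0) hh.aemeasurable]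
  rw [← lintegral_const_mul' _ _ (by simp), ← lintegral_const_mul' _ _ (by simp),
    ← lintegral_add_left' ?_]
  swap
  · refine Measurable.aemeasurable (Measurable.const_mul ?_ _)
    exact Antitone.measurable fun a b hab ↦ measure_mono fun x hx ↦ hab.trans_lt hx
  refine setLIntegral_mono_ae' measurableSet_Ioi (.of_forall fun r hr ↦ ?_)
  rw [mem_Ioi] at hr
  rcases lt_or_ge r 1 with hr1 | hr1
  · have h1 : ∀ (c : ℝ) (hc : 0 < c) (A : Set ℝ),
        ENNReal.ofReal c * volume A = volume (c • A) := fun c hc A ↦ by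
      rw [Measure.addHaar_smul]; simp [abs_of_pos hc]
    rw [h1 s hs, h1 t ht]
    refine Real.volume_add_le ((measurableSet_lt measurable_const hf).const_smul₀ s)
      ((measurableSet_lt measurable_const hg).const_smul₀ t) (Set.Nonempty.smul_set (hf2 r hr1))
      (Set.Nonempty.smul_set (hg2 r hr1)) ?_
    rintro _ ⟨_, ⟨x, hx, rfl⟩, _, ⟨y, hy, rfl⟩, rfl⟩
    refine lt_of_lt_of_le ?_ (hfgh x y)
    calc r = r ^ s * r ^ t := by rw [← Real.rpow_add hr, hst, Real.rpow_one]
      _ < f x ^ s * g y ^ t := by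
        have : r < f x := hx
        have : r < g y := hy
        have : 0 < f x := hr.trans hx
        gcongr
  · have : ∀ f : ℝ → ℝ, (∀ x, f x ≤ 1) → volume {a | r < f a} = 0 := fun f hf ↦ by
      rw [eq_empty_of_forall_notMem (s := {a | r < f a})]
      · simp
      · exact fun x hx ↦ not_lt.2 ((hf x).trans hr1) hx
    simp [this f hf1, this g hg1]

lemma prekopaLeindler_real_of_le {s t : ℝ} (hs : 0 < s) (ht : 0 < t) (hst : s + t = 1)
    {f g h : ℝ → ENNReal} (hf : Measurable f) (hg : Measurable g) (hh : Measurable h)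
    {k : ENNReal} (hk : k ≠ ⊤) (hfk : ∀ x, f x ≤ k) (hgk : ∀ x, g x ≤ k)
    (hfgh : ∀ x y, f x ^ s * g y ^ t ≤ h (s * x + t * y)) :
    (∫⁻ x, f x) ^ s * (∫⁻ x, g x) ^ t ≤ ∫⁻ x, h x := by
  set F := ⨆ x, f x with hF
  set G := ⨆ x, g x with hG
  have hFt : F ≠ ⊤ := ne_top_of_le_ne_top hk (iSup_le hfk)
  have hGt : G ≠ ⊤ := ne_top_of_le_ne_top hk (iSup_le hgk)
  rcases eq_or_ne F 0 with h0 | hF0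
  · have : f = 0 := funext fun x ↦ by simpa using (le_iSup f x).trans h0.le
    simp [this, hs]
  rcases eq_or_ne G 0 with h0 | hG0
  · have : g = 0 := funext fun x ↦ by simpa using (le_iSup g x).trans h0.le
    simp [this, ht]
  set M := F ^ s * G ^ t with hM
  have hFs0 : F ^ s ≠ 0 := by simp [ENNReal.rpow_eq_zero_iff, hF0, hFt]
  have hGt0 : G ^ t ≠ 0 := by simp [ENNReal.rpow_eq_zero_iff, hG0, hGt]
  have hFsT : F ^ s ≠ ⊤ := ENNReal.rpow_ne_top_of_nonneg hs.le hFt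
  have hGtT : G ^ t ≠ ⊤ := ENNReal.rpow_ne_top_of_nonneg ht.le hGt
  have hM0 : M ≠ 0 := mul_ne_zero hFs0 hGt0
  have hMt : M ≠ ⊤ := ENNReal.mul_ne_top hFsT hGtT
  have hf1 : ∀ x, f x / F ≤ 1 := fun x ↦ ENNReal.div_le_of_le_mul (by simpa using le_iSup f x)
  have hg1 : ∀ x, g x / G ≤ 1 := fun x ↦ ENNReal.div_le_of_le_mul (by simpa using le_iSup g x)
  have hf1t : ∀ x, f x / F ≠ ⊤ := fun x ↦ ne_top_of_le_ne_top ENNReal.one_ne_top (hf1 x)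
  have hg1t : ∀ x, g x / G ≠ ⊤ := fun x ↦ ne_top_of_le_ne_top ENNReal.one_ne_top (hg1 x)
  have hh1t : ∀ x, min 1 (h x / M) ≠ ⊤ := fun x ↦
    ne_top_of_le_ne_top ENNReal.one_ne_top (min_le_left _ _)
  have hsup : ∀ {f : ℝ → ENNReal}, ⨆ x, f x ≠ 0 → ⨆ x, f x ≠ ⊤ → (∀ x, f x / (⨆ x, f x) ≠ ⊤) →
      ∀ r : ℝ, r < 1 → ∃ x, r < (f x / ⨆ x, f x).toReal := by
    intro f h0 ht hft r hr
    have : ENNReal.ofReal r * (⨆ x, f x) < ⨆ x, f x := by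
      conv_rhs => rw [← one_mul (⨆ x, f x)]
      exact (ENNReal.mul_lt_mul_iff_left h0 ht).2 (by simpa using hr)
    obtain ⟨x, hx⟩ := lt_iSup_iff.1 this
    refine ⟨x, ?_⟩
    have h2 : ENNReal.ofReal r < f x / ⨆ x, f x :=
      (ENNReal.lt_div_iff_mul_lt (.inl h0) (.inl ht)).2 hx
    by_contra! h3
    have h4 := ENNReal.ofReal_le_ofReal h3
    rw [ENNReal.ofReal_toReal (hft x)] at h4
    exact h2.not_ge h4
  have key := lintegral_le_of_normalized hs ht hst (f := fun x ↦ (f x / F).toReal)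
    (g := fun x ↦ (g x / G).toReal) (h := fun x ↦ (min 1 (h x / M)).toReal)
    (by fun_prop) (by fun_prop) (by fun_prop) (fun _ ↦ ENNReal.toReal_nonneg)
    (fun _ ↦ ENNReal.toReal_nonneg) (fun _ ↦ ENNReal.toReal_nonneg)
    (fun x ↦ by simpa using ENNReal.toReal_mono ENNReal.one_ne_top (hf1 x))
    (fun x ↦ by simpa using ENNReal.toReal_mono ENNReal.one_ne_top (hg1 x))
    (hsup hF0 hFt hf1t) (hsup hG0 hGt hg1t) (fun x y ↦ by
      rw [ENNReal.toReal_rpow, ENNReal.toReal_rpow, ← ENNReal.toReal_mul]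
      refine ENNReal.toReal_mono (hh1t _) (le_min ?_ ?_)
      · exact mul_le_one' (ENNReal.rpow_le_one (hf1 x) hs.le) (ENNReal.rpow_le_one (hg1 y) ht.le)
      · rw [ENNReal.div_rpow_of_nonneg _ _ hs.le, ENNReal.div_rpow_of_nonneg _ _ ht.le,
          ENNReal.le_div_iff_mul_le (.inl hM0) (.inl hMt)]
        refine le_trans (le_of_eq ?_) (hfgh x y)
        rw [hM, mul_mul_mul_comm, ENNReal.div_mul_cancel hFs0 hFsT,
          ENNReal.div_mul_cancel hGt0 hGtT])
  simp_rw [ENNReal.ofReal_toReal (hf1t _), ENNReal.ofReal_toReal (hg1t _),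
    ENNReal.ofReal_toReal (hh1t _)] at key
  have h2 := (ENNReal.geom_mean_le_arith_mean2 hs ht hst _ _).trans
    (key.trans (lintegral_mono fun x ↦ min_le_right _ _))
  simp_rw [div_eq_mul_inv] at h2
  rw [lintegral_mul_const _ hf, lintegral_mul_const _ hg, lintegral_mul_const _ hh] at h2
  simp_rw [← div_eq_mul_inv] at h2
  rw [ENNReal.div_rpow_of_nonneg _ _ hs.le, ENNReal.div_rpow_of_nonneg _ _ ht.le,
    ENNReal.le_div_iff_mul_le (.inl hM0) (.inl hMt), hM, mul_mul_mul_comm,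
    ENNReal.div_mul_cancel hFs0 hFsT, ENNReal.div_mul_cancel hGt0 hGtT] at h2
  exact h2

lemma iSup_lintegral_min_natCast {f : ℝ → ENNReal} (hf : Measurable f) :
    ⨆ k : ℕ, ∫⁻ x, min (f x) k = ∫⁻ x, f x := by
  rw [← lintegral_iSup (fun k ↦ hf.min measurable_const)
    (fun i j hij x ↦ min_le_min_left _ (by exact_mod_cast hij))]
  congr with x
  rw [← inf_iSup_eq, ENNReal.iSup_natCast, inf_top_eq]

lemma prekopaLeindler_real {s t : ℝ} (hs : 0 < s) (ht : 0 < t) (hst : s + t = 1)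
    {f g h : ℝ → ENNReal} (hf : Measurable f) (hg : Measurable g) (hh : Measurable h)
    (hfgh : ∀ x y, f x ^ s * g y ^ t ≤ h (s * x + t * y)) :
    (∫⁻ x, f x) ^ s * (∫⁻ x, g x) ^ t ≤ ∫⁻ x, h x := by
  rw [← iSup_lintegral_min_natCast hf, ← iSup_lintegral_min_natCast hg]
  have hsup : ∀ {p : ℝ}, 0 < p → ∀ u : ℕ → ENNReal, (⨆ i, u i) ^ p = ⨆ i, u i ^ p :=
    fun hp u ↦ (ENNReal.orderIsoRpow _ hp).map_iSup u
  rw [hsup hs, hsup ht, ENNReal.iSup_mul]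
  refine iSup_le fun i ↦ ?_
  rw [ENNReal.mul_iSup]
  refine iSup_le fun j ↦ ?_
  refine prekopaLeindler_real_of_le hs ht hst (hf.min measurable_const) (hg.min measurable_const)
    hh (k := i + j) (by finiteness) (fun x ↦ (min_le_right _ _).trans le_self_add)
    (fun x ↦ (min_le_right _ _).trans le_add_self) fun x y ↦ le_trans ?_ (hfgh x y)
  gcongr <;> exact min_le_left _ _

/-- The Prékopa–Leindler inequality on `ℝⁿ`. -/
theorem prekopaLeindler {s t : ℝ} (hs : 0 < s) (ht : 0 < t) (hst : s + t = 1) (n : ℕ)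
    {f g h : (Fin n → ℝ) → ENNReal} (hf : Measurable f) (hg : Measurable g) (hh : Measurable h)
    (hfgh : ∀ x y, f x ^ s * g y ^ t ≤ h (s • x + t • y)) :
    (∫⁻ x, f x) ^ s * (∫⁻ x, g x) ^ t ≤ ∫⁻ x, h x := by
  induction n with
  | zero =>
    simp_rw [volume_pi, Measure.pi_of_empty _ 0, lintegral_dirac]
    convert hfgh 0 0
  | succ n ih =>
    have hmp := (volume_preserving_piFinSuccAbove (fun _ : Fin (n + 1) ↦ ℝ) 0).symm
    set e := (MeasurableEquiv.piFinSuccAbove (fun _ : Fin (n + 1) ↦ ℝ) 0).symm with he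
    have key : ∀ {f : (Fin (n + 1) → ℝ) → ENNReal}, Measurable f →
        ∫⁻ x, f x = ∫⁻ a, ∫⁻ y, f (e (a, y)) := by
      intro f hf
      rw [← hmp.lintegral_comp hf]
      exact lintegral_prod _ (hf.comp e.measurable).aemeasurable
    have hm : ∀ {f : (Fin (n + 1) → ℝ) → ENNReal}, Measurable f →
        Measurable fun a ↦ ∫⁻ y, f (e (a, y)) := fun hf ↦
      (hf.comp e.measurable).lintegral_prod_right'
    rw [key hf, key hg, key hh]
    refine prekopaLeindler_real hs ht hst (hm hf) (hm hg) (hm hh) fun a b ↦ ?_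
    refine ih (by fun_prop) (by fun_prop) (by fun_prop) fun x y ↦ ?_
    refine (hfgh _ _).trans (le_of_eq ?_)
    congr 1
    ext i
    refine Fin.cases ?_ (fun i ↦ ?_) i <;>
    simp [he, MeasurableEquiv.piFinSuccAbove]

theorem measure_rpow_mul_rpow_le {s t : ℝ} (hs : 0 < s) (ht : 0 < t) (hst : s + t = 1) {n : ℕ}
    {A B : Set (EuclideanSpace ℝ (Fin n))} (hA : IsCompact A) (hB : IsCompact B) :
    volume A ^ s * volume B ^ t ≤ volume (s • A + t • B) := by
  have hmp := PiLp.volume_preserving_toLp (Fin n)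
  have hC : IsCompact (s • A + t • B) := (hA.smul s).add (hB.smul t)
  have hm : ∀ {C : Set (EuclideanSpace ℝ (Fin n))}, IsCompact C →
      Measurable fun x : Fin n → ℝ ↦ C.indicator (1 : EuclideanSpace ℝ (Fin n) → ENNReal)
        (WithLp.toLp 2 x) := fun hC ↦
    (measurable_one.indicator hC.measurableSet).comp hmp.measurable
  have key : ∀ {C : Set (EuclideanSpace ℝ (Fin n))}, IsCompact C →
      volume C = ∫⁻ x : Fin n → ℝ, C.indicator 1 (WithLp.toLp 2 x) := fun {C} hC ↦ by
    rw [hmp.lintegral_comp (measurable_one.indicator hC.measurableSet),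
      lintegral_indicator_one hC.measurableSet]
  rw [key hA, key hB, key hC]
  refine prekopaLeindler hs ht hst n (hm hA) (hm hB) (hm hC) fun x y ↦ ?_
  by_cases hx : WithLp.toLp 2 x ∈ A
  · by_cases hy : WithLp.toLp 2 y ∈ B
    · rw [indicator_of_mem hx, indicator_of_mem hy, indicator_of_mem]
      · simp
      · exact add_mem_add (smul_mem_smul_set hx) (smul_mem_smul_set hy)
    · simp [indicator_of_notMem hy, ht]
  · simp [indicator_of_notMem hx, hs]

lemma volumeReal_smul {n : ℕ} {c : ℝ} (hc : 0 ≤ c) (A : Set (EuclideanSpace ℝ (Fin n))) :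
    volume.real (c • A) = c ^ n * volume.real A := by
  simp [measureReal_def, Measure.addHaar_smul, abs_of_nonneg hc, hc]

/-- The Brunn–Minkowski inequality for compact sets of positive volume. -/
theorem brunnMinkowski {n : ℕ} (hn : n ≠ 0) {A B : Set (EuclideanSpace ℝ (Fin n))}
    (hA : IsCompact A) (hB : IsCompact B) (hA0 : 0 < volume.real A) (hB0 : 0 < volume.real B) :
    volume.real A ^ (1 / n : ℝ) + volume.real B ^ (1 / n : ℝ) ≤
      volume.real (A + B) ^ (1 / n : ℝ) := by
  set a := volume.real A ^ (1 / n : ℝ) with ha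
  set b := volume.real B ^ (1 / n : ℝ) with hb
  have ha0 : 0 < a := Real.rpow_pos_of_pos hA0 _
  have hb0 : 0 < b := Real.rpow_pos_of_pos hB0 _
  have han : a ^ n = volume.real A := by
    rw [ha, ← Real.rpow_natCast, ← Real.rpow_mul hA0.le, one_div_mul_cancel (by simpa),
      Real.rpow_one]
  have hbn : b ^ n = volume.real B := by
    rw [hb, ← Real.rpow_natCast, ← Real.rpow_mul hB0.le, one_div_mul_cancel (by simpa),
      Real.rpow_one]
  have hAu : volume (a⁻¹ • A) = 1 := by
    rw [← ENNReal.toReal_eq_one_iff, ← measureReal_def, volumeReal_smul (by positivity), ← han,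
      ← mul_pow, inv_mul_cancel₀ ha0.ne', one_pow]
  have hBu : volume (b⁻¹ • B) = 1 := by
    rw [← ENNReal.toReal_eq_one_iff, ← measureReal_def, volumeReal_smul (by positivity), ← hbn,
      ← mul_pow, inv_mul_cancel₀ hb0.ne', one_pow]
  have key := measure_rpow_mul_rpow_le (s := a / (a + b)) (t := b / (a + b)) (by positivity)
    (by positivity) (by field_simp) (hA.smul a⁻¹) (hB.smul b⁻¹)
  rw [hAu, hBu, ENNReal.one_rpow, ENNReal.one_rpow, one_mul, smul_smul, smul_smul] at key
  have h1 : a / (a + b) * a⁻¹ = (a + b)⁻¹ := by field_simp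
  have h2 : b / (a + b) * b⁻¹ = (a + b)⁻¹ := by field_simp
  rw [h1, h2, ← smul_add] at key
  have key2 := ENNReal.toReal_mono ((hA.add hB).smul (a + b)⁻¹).measure_lt_top.ne key
  rw [ENNReal.toReal_one, ← measureReal_def, volumeReal_smul (by positivity), inv_pow,
    inv_mul_eq_div, one_le_div (by positivity)] at key2
  calc a + b = ((a + b) ^ n) ^ (1 / n : ℝ) := by
        rw [one_div, Real.pow_rpow_inv_natCast (by positivity) hn]
    _ ≤ _ := by gcongr

section Gauge

variable {E : Type*} [NormedAddCommGroup E] [NormedSpace ℝ E]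

lemma gauge_le_iff_mem_smul {C : Set E} (hC : IsClosed C) (hconv : Convex ℝ C)
    (h0 : C ∈ nhds 0) {x : E} {r : ℝ} (hr : 0 < r) : gauge C x ≤ r ↔ x ∈ r • C := by
  refine ⟨fun h ↦ ?_, gauge_le_of_mem hr.le⟩
  rw [mem_smul_set_iff_inv_smul_mem₀ hr.ne']
  have : gauge C (r⁻¹ • x) ≤ 1 := by
    rw [gauge_smul_of_nonneg (by positivity), smul_eq_mul, inv_mul_le_iff₀ hr]
    simpa
  rw [gauge_le_one_iff_mem_closure hconv h0, hC.closure_eq] at this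
  exact this

/-- A functional bounded by `c` on `C` is bounded by `c` times the gauge of `C`. -/
lemma le_mul_gauge_of_forall_le {C : Set E} (h0 : C ∈ nhds 0) (p : E →L[ℝ] ℝ) {c : ℝ}
    (hc : 0 ≤ c) (hp : ∀ y ∈ C, p y ≤ c) (x : E) : p x ≤ c * gauge C x := by
  refine le_of_forall_pos_le_add fun ε hε ↦ ?_
  obtain ⟨r, hr0, hr, y, hy, rfl⟩ := exists_lt_of_gauge_lt (absorbent_nhds_zero h0)
    (show gauge C x < gauge C x + ε / (c + 1) by linarith [show 0 < ε / (c + 1) by positivity])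
  have hε' : c * (ε / (c + 1)) ≤ ε := by
    rw [mul_div_left_comm]
    exact mul_le_of_le_one_right hε.le (by rw [div_le_one (by positivity)]; linarith)
  calc p (r • y) = r * p y := by simp
    _ ≤ r * c := by gcongr; exact hp y hy
    _ ≤ _ := by nlinarith

variable {A : Set E} {x : E}

lemma fderiv_gauge_apply_self (hx : DifferentiableAt ℝ (gauge A) x) :
    fderiv ℝ (gauge A) x x = gauge A x := by
  have h1 : HasDerivAt (fun r : ℝ ↦ r • x) x 1 := by
    simpa using HasDerivAt.smul_const (hasDerivAt_id (1 : ℝ)) x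
  have h2 : HasDerivAt (fun r : ℝ ↦ gauge A (r • x)) (fderiv ℝ (gauge A) x x) 1 := by
    have : HasFDerivAt (gauge A) (fderiv ℝ (gauge A) x) ((1 : ℝ) • x) := by
      simpa using hx.hasFDerivAt
    exact this.comp_hasDerivAt 1 h1
  have h3 : HasDerivAt (fun r : ℝ ↦ r * gauge A x) (gauge A x) 1 := by
    simpa using (hasDerivAt_id (1 : ℝ)).mul_const (gauge A x)
  refine (h2.congr_of_eventuallyEq ?_).unique h3 |>.symm ▸ rfl
  filter_upwards [lt_mem_nhds one_pos] with r hr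
  rw [gauge_smul_of_nonneg (le_of_lt hr), smul_eq_mul]

lemma fderiv_gauge_apply_le (hconv : Convex ℝ A) (h0 : A ∈ nhds 0)
    (hx : DifferentiableAt ℝ (gauge A) x) (y : E) : fderiv ℝ (gauge A) x y ≤ gauge A y := by
  have h1 : HasDerivAt (fun r : ℝ ↦ x + r • y) y 0 := by
    simpa using (HasDerivAt.smul_const (hasDerivAt_id (0 : ℝ)) y).const_add x
  have h2 : HasDerivAt (fun r : ℝ ↦ gauge A (x + r • y)) (fderiv ℝ (gauge A) x y) 0 := by
    have : HasFDerivAt (gauge A) (fderiv ℝ (gauge A) x) (x + (0 : ℝ) • y) := by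
      simpa using hx.hasFDerivAt
    exact this.comp_hasDerivAt 0 h1
  have h3 := h2.tendsto_slope_zero_right
  refine le_of_tendsto h3 ?_
  filter_upwards [self_mem_nhdsWithin] with r hr
  rw [mem_Ioi] at hr
  have := gauge_add_le hconv (absorbent_nhds_zero h0) x (r • y)
  rw [gauge_smul_of_nonneg hr.le, smul_eq_mul] at this
  simp only [zero_add, zero_smul, add_zero, smul_eq_mul]
  rw [inv_mul_le_iff₀ hr]
  linarith

/-- If `A = {x | x + δK ⊆ B}` then a unit normal functional of `A` at a smooth boundary point
supports `B` as well, shifted by `δ` times the support function of `K`. -/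
lemma exists_fderiv_gauge_apply_le {K B : Set E} {δ : ℝ} (hconv : Convex ℝ A) (h0 : A ∈ nhds 0)
    (hK : IsCompact K) (hB : Convex ℝ B) (hAB : A = {x | ∀ y ∈ K, x + δ • y ∈ B})
    (hx : DifferentiableAt ℝ (gauge A) x) (hx0 : 0 < gauge A x) :
    ∃ k ∈ K, ∀ b ∈ B, fderiv ℝ (gauge A) x b ≤ 1 + δ * fderiv ℝ (gauge A) x k := by
  set g := gauge A with hg
  set z := (g x)⁻¹ • x with hz
  have hgz : g z = 1 := by
    rw [hg, hz, gauge_smul_of_nonneg (by positivity), smul_eq_mul, inv_mul_cancel₀ hx0.ne']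
  have hxz : x = g x • z := by rw [hz, smul_inv_smul₀ hx0.ne']
  obtain ⟨k, hkK, hk⟩ : ∃ k ∈ K, z + δ • k ∉ interior B := by
    by_contra! hcon
    have hcpt : IsCompact ((fun k ↦ z + δ • k) '' K) := hK.image (by fun_prop)
    obtain ⟨ε, hε, hthick⟩ := hcpt.exists_thickening_subset_open isOpen_interior
      (by rintro _ ⟨k, hk, rfl⟩; exact hcon k hk)
    have : z ∈ interior A := by
      rw [mem_interior_iff_mem_nhds]
      filter_upwards [Metric.ball_mem_nhds z hε] with w hw
      rw [hAB]
      intro k hk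
      refine interior_subset (hthick ?_)
      rw [Metric.mem_thickening_iff]
      exact ⟨z + δ • k, ⟨k, hk, rfl⟩, by simpa using hw⟩
    exact ((gauge_lt_one_iff_mem_interior hconv h0).2 this).ne hgz
  refine ⟨k, hkK, ?_⟩
  have hAk : ∀ a ∈ A, a + δ • k ∈ B := fun a ha ↦ by
    rw [hAB] at ha
    exact ha k hkK
  have hintB : (interior B).Nonempty := by
    refine ⟨δ • k, mem_interior_iff_mem_nhds.2 ?_⟩
    have : (fun w ↦ w - δ • k) ⁻¹' A ∈ nhds (δ • k) :=
      ContinuousAt.preimage_mem_nhds (by fun_prop) (by simpa using h0)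
    filter_upwards [this] with w hw
    simpa using hAk _ hw
  obtain ⟨u, hu⟩ := geometric_hahn_banach_open_point hB.interior isOpen_interior hk
  have huB : ∀ b ∈ B, u b ≤ u (z + δ • k) := fun b hb ↦ by
    have hb' : b ∈ closure (interior B) := by
      rw [hB.closure_interior_eq_closure_of_nonempty_interior hintB]
      exact subset_closure hb
    exact closure_minimal (fun y hy ↦ (hu y hy).le) (isClosed_le u.continuous continuous_const) hb'
  have huA : ∀ a ∈ A, u a ≤ u z := fun a ha ↦ by
    have := huB _ (hAk a ha)
    simpa using this
  have h0A : (0 : E) ∈ A := mem_of_mem_nhds h0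
  have huz0 : 0 ≤ u z := by simpa using huA 0 h0A
  have hule := le_mul_gauge_of_forall_le h0 u huz0 huA
  have huz : 0 < u z := by
    refine huz0.lt_of_ne fun h ↦ ?_
    obtain ⟨b, hb⟩ := hintB
    have h1 : ∀ y, u y = 0 := fun y ↦ by
      have h1 := hule y
      have h2 := hule (-y)
      rw [← h, zero_mul] at h1 h2
      rw [map_neg] at h2
      linarith
    have := hu b hb
    simp [h1] at this
  have hmin : IsLocalMin (fun y ↦ u z * g y - u y) x := .of_forall fun y ↦ by
    have h1 := hule y
    have h2 : u x = g x * u z := by conv_lhs => rw [hxz, map_smul, smul_eq_mul]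
    simp only
    rw [h2]
    linarith
  have hfd : u z • fderiv ℝ g x - u = 0 :=
    hmin.hasFDerivAt_eq_zero ((hx.hasFDerivAt.const_mul (u z)).sub u.hasFDerivAt)
  have hval : ∀ y, u y = u z * fderiv ℝ g x y := fun y ↦ by
    have := DFunLike.congr_fun hfd y
    simp at this
    linarith
  intro b hb
  have h1 := huB b hb
  rw [map_add u, map_smul u δ k, smul_eq_mul, hval b, hval k] at h1
  refine le_of_mul_le_mul_left (a := u z) ?_ huz
  linarith

end Gauge

section GaugeIntegral

variable {n : ℕ} {A K : Set (EuclideanSpace ℝ (Fin n))}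

lemma lintegral_exp_neg_gauge (hA : IsCompact A) (hconv : Convex ℝ A) (h0 : A ∈ nhds 0) :
    ∫⁻ x, ENNReal.ofReal (Real.exp (-gauge A x)) =
      ENNReal.ofReal (n.factorial * volume.real A) := by
  have hg : Continuous (gauge A) := continuous_gauge hconv h0
  have h1 : ∀ x, ENNReal.ofReal (Real.exp (-gauge A x)) =
      ∫⁻ t in Ioi (0 : ℝ), {p : _ × ℝ | gauge A p.1 ≤ p.2}.indicator
        (fun p ↦ ENNReal.ofReal (Real.exp (-p.2))) (x, t) := fun x ↦ by
    rw [← integral_exp_neg_Ioi, ofReal_integral_eq_lintegral_ofReal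
      (integrableOn_exp_neg_Ioi _) (.of_forall fun _ ↦ (Real.exp_pos _).le),
      setLIntegral_congr Ioi_ae_eq_Ici, setLIntegral_congr (s := Ioi 0) Ioi_ae_eq_Ici,
      ← lintegral_indicator measurableSet_Ici, ← lintegral_indicator measurableSet_Ici]
    congr with t
    have := gauge_nonneg (s := A) x
    by_cases h : gauge A x ≤ t
    · simp [indicator, h, this.trans h]
    · simp [indicator, h]
  have hm : Measurable ({p : EuclideanSpace ℝ (Fin n) × ℝ | gauge A p.1 ≤ p.2}.indicator
      (fun p ↦ ENNReal.ofReal (Real.exp (-p.2)))) := by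
    refine Measurable.indicator (by fun_prop) ?_
    exact measurableSet_le (hg.measurable.comp measurable_fst) measurable_snd
  simp_rw [h1]
  rw [lintegral_lintegral_swap (f := fun x t ↦
    {p : EuclideanSpace ℝ (Fin n) × ℝ | gauge A p.1 ≤ p.2}.indicator
      (fun p ↦ ENNReal.ofReal (Real.exp (-p.2))) (x, t)) hm.aemeasurable]
  have h2 : ∀ t ∈ Ioi (0 : ℝ), ∫⁻ x, {p : EuclideanSpace ℝ (Fin n) × ℝ | gauge A p.1 ≤ p.2}.indicator
        (fun p ↦ ENNReal.ofReal (Real.exp (-p.2))) (x, t) =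
      ENNReal.ofReal (Real.exp (-t) * t ^ ((n + 1 : ℝ) - 1)) * volume A := fun t ht ↦ by
    rw [mem_Ioi] at ht
    have : ∀ x, {p : EuclideanSpace ℝ (Fin n) × ℝ | gauge A p.1 ≤ p.2}.indicator
        (fun p ↦ ENNReal.ofReal (Real.exp (-p.2))) (x, t) =
        (t • A).indicator (fun _ ↦ ENNReal.ofReal (Real.exp (-t))) x := fun x ↦ by
      by_cases h : gauge A x ≤ t
      · rw [indicator_of_mem ((gauge_le_iff_mem_smul hA.isClosed hconv h0 ht).1 h)]
        simp [indicator, h]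
      · rw [indicator_of_notMem (h ∘ (gauge_le_iff_mem_smul hA.isClosed hconv h0 ht).2)]
        simp [indicator, h]
    simp_rw [this]
    rw [lintegral_indicator_const (hA.smul t).measurableSet, Measure.addHaar_smul,
      ENNReal.ofReal_mul (Real.exp_pos _).le]
    simp [abs_of_pos ht, mul_assoc]
  rw [setLIntegral_congr_fun measurableSet_Ioi h2, lintegral_mul_const _ (by fun_prop),
    ← ofReal_integral_eq_lintegral_ofReal (Real.GammaIntegral_convergent (by positivity)),
    ← Real.Gamma_eq_integral (by positivity), Real.Gamma_nat_eq_factorial,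
    ENNReal.ofReal_mul (by positivity), measureReal_def, ENNReal.ofReal_toReal hA.measure_lt_top.ne]
  filter_upwards [ae_restrict_mem measurableSet_Ioi] with t ht
  exact mul_nonneg (Real.exp_pos _).le (Real.rpow_nonneg (le_of_lt ht) _)

lemma integrable_exp_neg_gauge (hA : IsCompact A) (hconv : Convex ℝ A) (h0 : A ∈ nhds 0) :
    Integrable fun x ↦ Real.exp (-gauge A x) := by
  have hg : Continuous (gauge A) := continuous_gauge hconv h0
  refine ⟨by fun_prop, ?_⟩
  rw [hasFiniteIntegral_iff_ofReal (.of_forall fun _ ↦ (Real.exp_pos _).le),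
    lintegral_exp_neg_gauge hA hconv h0]
  exact ENNReal.ofReal_lt_top

lemma integral_exp_neg_gauge (hA : IsCompact A) (hconv : Convex ℝ A) (h0 : A ∈ nhds 0) :
    ∫ x, Real.exp (-gauge A x) = n.factorial * volume.real A := by
  rw [integral_eq_lintegral_of_nonneg_ae (.of_forall fun _ ↦ (Real.exp_pos _).le)
    (integrable_exp_neg_gauge hA hconv h0).aestronglyMeasurable,
    lintegral_exp_neg_gauge hA hconv h0, ENNReal.toReal_ofReal (by positivity)]

lemma integrable_gauge_mul_exp (hA : IsCompact A) (hconv : Convex ℝ A) (h0 : A ∈ nhds 0) (c : ℝ) :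
    Integrable fun x ↦ c * gauge A x * Real.exp (-gauge A x / 2) := by
  have hg : Continuous (gauge A) := continuous_gauge hconv h0
  simp_rw [mul_assoc]
  refine Integrable.const_mul ?_ c
  have h4 := (integrable_exp_neg_gauge (hA.smul (4 : ℝ)) (hconv.smul 4)
    ((set_smul_mem_nhds_zero_iff (by norm_num)).2 h0)).const_mul 4
  refine h4.mono' (by fun_prop) (.of_forall fun x ↦ ?_)
  have hx := gauge_nonneg (s := A) x
  rw [gauge_smul_left_of_nonneg (by norm_num), Real.norm_of_nonneg (by positivity)]
  simp only [Pi.smul_apply, smul_eq_mul]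
  have h1 : gauge A x ≤ 4 * Real.exp (gauge A x / 4) := by
    linarith [Real.add_one_le_exp (gauge A x / 4)]
  calc gauge A x * Real.exp (-gauge A x / 2)
      ≤ 4 * Real.exp (gauge A x / 4) * Real.exp (-gauge A x / 2) := by gcongr
    _ = 4 * Real.exp (-(4⁻¹ * gauge A x)) := by
      rw [mul_assoc, ← Real.exp_add]
      ring_nf

variable (A K) in
/-- The first order decrease of the gauge of `A + sK` at `s = 0`: the gauge of `A` times the
support function of `K` in the normal direction. -/
def gaugeVariation (x : EuclideanSpace ℝ (Fin n)) : ℝ :=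
  gauge A x * sSup ((fun k ↦ fderiv ℝ (gauge A) x k) '' K)

lemma exists_supportFun_eq (hK : IsCompact K) (hK0 : (0 : EuclideanSpace ℝ (Fin n)) ∈ K)
    (p : EuclideanSpace ℝ (Fin n) →L[ℝ] ℝ) :
    ∃ k ∈ K, sSup ((fun k ↦ p k) '' K) = p k ∧ ∀ k' ∈ K, p k' ≤ p k :=
  hK.exists_sSup_image_eq_and_ge ⟨0, hK0⟩ p.continuous.continuousOn

lemma measurable_gaugeVariation (hconv : Convex ℝ A) (h0 : A ∈ nhds 0) (hK : IsCompact K) :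
    Measurable (gaugeVariation A K) := by
  have h1 : Continuous fun p : EuclideanSpace ℝ (Fin n) →L[ℝ] ℝ ↦ sSup ((fun k ↦ p k) '' K) :=
    hK.continuous_sSup (f := fun (p : EuclideanSpace ℝ (Fin n) →L[ℝ] ℝ) k ↦ p k)
      isBoundedBilinearMap_apply.continuous
  exact (continuous_gauge hconv h0).measurable.mul
    (h1.measurable.comp (measurable_fderiv ℝ (gauge A)))

lemma gaugeVariation_nonneg (hK : IsCompact K) (hK0 : 0 ∈ K) (x : EuclideanSpace ℝ (Fin n)) :
    0 ≤ gaugeVariation A K x := by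
  obtain ⟨k, -, h1, h2⟩ := exists_supportFun_eq hK hK0 (fderiv ℝ (gauge A) x)
  rw [gaugeVariation, h1]
  exact mul_nonneg (gauge_nonneg _) (by simpa using h2 0 hK0)

lemma gaugeVariation_le (hconv : Convex ℝ A) (h0 : A ∈ nhds 0) (hK : IsCompact K) (hK0 : 0 ∈ K)
    {c : ℝ} (hc : 0 ≤ c) (hKA : K ⊆ c • A) (x : EuclideanSpace ℝ (Fin n)) :
    gaugeVariation A K x ≤ c * gauge A x := by
  obtain ⟨k, hkK, h1, -⟩ := exists_supportFun_eq hK hK0 (fderiv ℝ (gauge A) x)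
  rw [gaugeVariation, h1, mul_comm]
  refine mul_le_mul_of_nonneg_right ?_ (gauge_nonneg x)
  by_cases hx : DifferentiableAt ℝ (gauge A) x
  · exact (fderiv_gauge_apply_le hconv h0 hx k).trans (gauge_le_of_mem hc (hKA hkK))
  · simpa [fderiv_zero_of_not_differentiableAt hx]

/-- A set lying below the supporting functional of `A + sK` at `x` has large gauge at `x`. -/
lemma gauge_sub_gaugeVariation_le {C : Set (EuclideanSpace ℝ (Fin n))}
    (hC : C ∈ nhds 0) (hK : IsCompact K) (hK0 : 0 ∈ K) {x : EuclideanSpace ℝ (Fin n)}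
    (hx : DifferentiableAt ℝ (gauge A) x) {s : ℝ} (hs : 0 ≤ s)
    (h : 0 < gauge A x → ∀ y ∈ C, fderiv ℝ (gauge A) x y ≤
      1 + s * sSup ((fun k ↦ fderiv ℝ (gauge A) x k) '' K)) :
    gauge A x - s * gaugeVariation A K x ≤ gauge C x := by
  obtain ⟨k, -, h1, h2⟩ := exists_supportFun_eq hK hK0 (fderiv ℝ (gauge A) x)
  have hσ : 0 ≤ sSup ((fun k ↦ fderiv ℝ (gauge A) x k) '' K) := by
    rw [h1]; simpa using h2 0 hK0
  rw [gaugeVariation]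
  set σ := sSup ((fun k ↦ fderiv ℝ (gauge A) x k) '' K)
  rcases (gauge_nonneg (s := A) x).eq_or_lt with hx0 | hx0
  · rw [← hx0]
    simpa using gauge_nonneg x
  have h3 := le_mul_gauge_of_forall_le hC (fderiv ℝ (gauge A) x) (by positivity) (h hx0) x
  rw [fderiv_gauge_apply_self hx] at h3
  have h4 : 0 ≤ s * σ := by positivity
  have h5 := mul_nonneg h4 h4
  by_contra! hlt
  have : (1 + s * σ) * gauge C x < (1 + s * σ) * (gauge A x - s * (gauge A x * σ)) := by gcongr
  nlinarith

lemma gauge_add_smul_le_eventually (hA : IsClosed A) (hconv : Convex ℝ A) (h0 : A ∈ nhds 0)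
    {x k : EuclideanSpace ℝ (Fin n)} (hk : k ∈ K) (hx : DifferentiableAt ℝ (gauge A) x)
    (hx0 : 0 < gauge A x) {ε : ℝ} (hε : 0 < ε) :
    ∀ᶠ s in nhdsWithin 0 (Ioi (0 : ℝ)), gauge (A + s • K) x ≤
      gauge A x - s * (gauge A x * (fderiv ℝ (gauge A) x k - ε)) := by
  set σ := fderiv ℝ (gauge A) x k with hσ
  set τ : ℝ → ℝ := fun s ↦ gauge A x - s * (gauge A x * (σ - ε)) with hτ
  have hτ0 : τ 0 = gauge A x := by simp [hτ]
  have hτd : HasDerivAt τ (-(gauge A x * (σ - ε))) 0 := by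
    simpa using ((hasDerivAt_id (0 : ℝ)).mul_const (gauge A x * (σ - ε))).const_sub (gauge A x)
  have hvd : HasDerivAt (fun s ↦ x - (τ s * s) • k) (-(gauge A x • k)) 0 := by
    have := HasDerivAt.smul_const (hτd.mul (hasDerivAt_id (0 : ℝ))) k
    simpa [hτ0] using this.const_sub x
  have hgd : HasDerivAt (fun s ↦ gauge A (x - (τ s * s) • k) - τ s)
      (fderiv ℝ (gauge A) x (-(gauge A x • k)) - -(gauge A x * (σ - ε))) 0 := by
    have : HasFDerivAt (gauge A) (fderiv ℝ (gauge A) x) (x - (τ 0 * 0) • k) := by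
      simpa using hx.hasFDerivAt
    exact (this.comp_hasDerivAt 0 hvd).sub hτd
  have hneg : fderiv ℝ (gauge A) x (-(gauge A x • k)) - -(gauge A x * (σ - ε)) < 0 := by
    rw [map_neg, map_smul, smul_eq_mul, ← hσ]
    nlinarith [mul_pos hx0 hε]
  have hev := hgd.tendsto_slope_zero_right.eventually_lt_const hneg
  have hτpos : ∀ᶠ s in nhdsWithin 0 (Ioi (0 : ℝ)), 0 < τ s :=
    (hτd.continuousAt.tendsto.mono_left nhdsWithin_le_nhds).eventually_const_lt (by rwa [hτ0])
  filter_upwards [hev, hτpos, self_mem_nhdsWithin] with s h1 h2 hs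
  rw [mem_Ioi] at hs
  have h3 : gauge A (x - (τ s * s) • k) ≤ τ s := by
    simp only [zero_add, mul_zero, zero_smul, sub_zero, hτ0, smul_eq_mul, sub_self] at h1
    have := neg_of_mul_neg_right h1 (inv_pos.2 hs).le
    linarith
  refine gauge_le_of_mem h2.le ?_
  obtain ⟨a, ha, hax⟩ := (gauge_le_iff_mem_smul hA hconv h0 h2).1 h3
  refine ⟨a + s • k, add_mem_add ha (smul_mem_smul_set hk), ?_⟩
  simp only at hax ⊢
  rw [smul_add, hax, smul_smul, sub_add_cancel]

end GaugeIntegral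

section VolumeVariation

variable {n : ℕ} {A K : Set (EuclideanSpace ℝ (Fin n))}

lemma exists_subset_smul (hA : IsClosed A) (hconv : Convex ℝ A) (h0 : A ∈ nhds 0)
    (hK : IsCompact K) : ∃ c : ℝ, 0 < c ∧ K ⊆ c • A := by
  obtain ⟨M, hM⟩ := (hK.image (continuous_gauge hconv h0)).bddAbove
  refine ⟨max M 1, by positivity, fun k hk ↦ ?_⟩
  rw [← gauge_le_iff_mem_smul hA hconv h0 (by positivity)]
  exact (hM ⟨k, hk, rfl⟩).trans (le_max_left _ _)

lemma hasDerivAt_integral_exp_gaugeVariation (hA : IsCompact A) (hconv : Convex ℝ A)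
    (h0 : A ∈ nhds 0) (hK : IsCompact K) (hK0 : 0 ∈ K) :
    (∀ᶠ s in nhds (0 : ℝ), Integrable fun x ↦ Real.exp (-(gauge A x - s * gaugeVariation A K x))) ∧
    HasDerivAt (fun s : ℝ ↦ ∫ x, Real.exp (-(gauge A x - s * gaugeVariation A K x)))
      (∫ x, Real.exp (-gauge A x) * gaugeVariation A K x) 0 := by
  obtain ⟨c, hc, hKA⟩ := exists_subset_smul hA.isClosed hconv h0 hK
  have hg : Measurable (gauge A) := (continuous_gauge hconv h0).measurable
  have hD := measurable_gaugeVariation hconv h0 hK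
  have hmem : Iio (1 / (2 * c)) ∈ nhds (0 : ℝ) := Iio_mem_nhds (by positivity)
  have hbd : ∀ x, ∀ s ∈ Iio (1 / (2 * c)),
      -(gauge A x - s * gaugeVariation A K x) ≤ -gauge A x / 2 := fun x s hs ↦ by
    rw [mem_Iio, lt_div_iff₀ (by positivity)] at hs
    have h1 := gaugeVariation_nonneg (A := A) hK hK0 x
    have h2 := gaugeVariation_le hconv h0 hK hK0 hc.le hKA x
    have h3 := gauge_nonneg (s := A) x
    rcases le_or_gt s 0 with h | h
    · nlinarith
    · nlinarith
  have hint2 : Integrable fun x ↦ Real.exp (-gauge A x / 2) := by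
    have h2 := integrable_exp_neg_gauge (hA.smul (2 : ℝ)) (hconv.smul 2)
      ((set_smul_mem_nhds_zero_iff (by norm_num)).2 h0)
    convert h2 using 3 with x
    rw [gauge_smul_left_of_nonneg (by norm_num)]
    simp only [Pi.smul_apply, smul_eq_mul]
    ring
  constructor
  · filter_upwards [hmem] with s hs
    refine hint2.mono' (Measurable.aestronglyMeasurable (by fun_prop)) (.of_forall fun x ↦ ?_)
    rw [Real.norm_of_nonneg (Real.exp_pos _).le]
    exact Real.exp_le_exp.2 (hbd x s hs)
  · have := (hasDerivAt_integral_of_dominated_loc_of_deriv_le (𝕜 := ℝ) (μ := volume) (x₀ := (0 : ℝ))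
      (F := fun s x ↦ Real.exp (-(gauge A x - s * gaugeVariation A K x)))
      (F' := fun s x ↦ Real.exp (-(gauge A x - s * gaugeVariation A K x)) * gaugeVariation A K x)
      (bound := fun x ↦ c * gauge A x * Real.exp (-gauge A x / 2)) hmem
      (.of_forall fun s ↦ Measurable.aestronglyMeasurable (by fun_prop))
      (by simpa using integrable_exp_neg_gauge hA hconv h0)
      (Measurable.aestronglyMeasurable (by fun_prop)) (.of_forall fun x s hs ↦ ?_)
      (integrable_gauge_mul_exp hA hconv h0 c) (.of_forall fun x s hs ↦ ?_)).2
    · simpa using this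
    · have h1 := gaugeVariation_nonneg (A := A) hK hK0 x
      have h2 := gaugeVariation_le hconv h0 hK hK0 hc.le hKA x
      have h3 : 0 ≤ c * gauge A x := mul_nonneg hc.le (gauge_nonneg x)
      rw [Real.norm_of_nonneg (by positivity), mul_comm]
      gcongr
      exact hbd x s hs
    · have := ((hasDerivAt_id s).mul_const (gaugeVariation A K x)).const_sub (gauge A x)
      simpa using this.neg.exp

lemma subset_add_smul (hK0 : 0 ∈ K) (s : ℝ) : A ⊆ A + s • K := fun a ha ↦ by
  simpa using add_mem_add ha (smul_mem_smul_set (a := s) hK0)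

lemma gauge_sub_gaugeVariation_le_gauge_add (hconv : Convex ℝ A) (h0 : A ∈ nhds 0)
    (hK : IsCompact K) (hK0 : 0 ∈ K) {x : EuclideanSpace ℝ (Fin n)}
    (hx : DifferentiableAt ℝ (gauge A) x) {s : ℝ} (hs : 0 ≤ s) :
    gauge A x - s * gaugeVariation A K x ≤ gauge (A + s • K) x := by
  refine gauge_sub_gaugeVariation_le (Filter.mem_of_superset h0 (subset_add_smul hK0 s))
    hK hK0 hx hs fun _ ↦ ?_
  rintro _ ⟨a, ha, _, ⟨k, hk, rfl⟩, rfl⟩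
  obtain ⟨k', -, h1, h2⟩ := exists_supportFun_eq hK hK0 (fderiv ℝ (gauge A) x)
  rw [map_add, map_smul, h1, smul_eq_mul]
  have := (fderiv_gauge_apply_le hconv h0 hx a).trans (gauge_le_one_of_mem ha)
  have := mul_le_mul_of_nonneg_left (h2 k hk) hs
  linarith

lemma hasDerivWithinAt_gauge_add_smul (hA : IsClosed A) (hconv : Convex ℝ A) (h0 : A ∈ nhds 0)
    (hK : IsCompact K) (hK0 : 0 ∈ K) {x : EuclideanSpace ℝ (Fin n)}
    (hx : DifferentiableAt ℝ (gauge A) x) :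
    HasDerivWithinAt (fun s : ℝ ↦ gauge (A + s • K) x) (-gaugeVariation A K x) (Ioi 0) 0 := by
  rw [hasDerivWithinAt_iff_tendsto_slope' self_notMem_Ioi]
  have hK0' : A + (0 : ℝ) • K = A := by rw [zero_smul_set ⟨0, hK0⟩, add_zero]
  have hlow : ∀ s ∈ Ioi (0 : ℝ), -gaugeVariation A K x ≤
      slope (fun s : ℝ ↦ gauge (A + s • K) x) 0 s := fun s hs ↦ by
    have h := gauge_sub_gaugeVariation_le_gauge_add hconv h0 hK hK0 hx (le_of_lt hs)
    rw [slope_def_field, hK0', sub_zero, le_div_iff₀ hs]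
    linarith
  rcases (gauge_nonneg (s := A) x).eq_or_lt with hx0 | hx0
  · have hz : ∀ s : ℝ, gauge (A + s • K) x = 0 := fun s ↦
      le_antisymm ((gauge_mono (absorbent_nhds_zero h0) (subset_add_smul hK0 s) x).trans
        hx0.ge) (gauge_nonneg x)
    have : slope (fun _ : ℝ ↦ (0 : ℝ)) 0 = fun _ ↦ 0 := by ext; simp [slope_def_field]
    simp [hz, gaugeVariation, ← hx0, this]
  refine Metric.tendsto_nhds.2 fun ε hε ↦ ?_
  obtain ⟨k, hkK, h1, -⟩ := exists_supportFun_eq hK hK0 (fderiv ℝ (gauge A) x)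
  have hε' : 0 < ε / (2 * gauge A x) := by positivity
  filter_upwards [gauge_add_smul_le_eventually hA hconv h0 hkK hx hx0 hε', self_mem_nhdsWithin]
    with s hup hs
  have hlow := hlow s hs
  have hup' : slope (fun s : ℝ ↦ gauge (A + s • K) x) 0 s ≤ -gaugeVariation A K x + ε / 2 := by
    rw [slope_def_field, hK0', sub_zero, div_le_iff₀ hs, gaugeVariation, h1]
    have : gauge A x * (ε / (2 * gauge A x)) = ε / 2 := by field_simp
    rw [mul_sub, this] at hup
    linarith
  rw [Real.dist_eq, abs_lt]
  constructor <;> linarith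

lemma hasDerivWithinAt_volume_add_smul (hA : IsCompact A) (hconv : Convex ℝ A)
    (h0 : A ∈ nhds 0) (hK : IsCompact K) (hKconv : Convex ℝ K) (hK0 : 0 ∈ K) :
    HasDerivWithinAt (fun s : ℝ ↦ volume.real (A + s • K))
      ((∫ x, Real.exp (-gauge A x) * gaugeVariation A K x) / n.factorial) (Ici 0) 0 := by
  obtain ⟨c, hc, hKA⟩ := exists_subset_smul hA.isClosed hconv h0 hK
  have hcpt : ∀ s : ℝ, IsCompact (A + s • K) := fun s ↦ hA.add (hK.smul s)
  have hcv : ∀ s : ℝ, Convex ℝ (A + s • K) := fun s ↦ hconv.add (hKconv.smul s)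
  have hnh : ∀ s : ℝ, A + s • K ∈ nhds 0 := fun s ↦
    Filter.mem_of_superset h0 (subset_add_smul hK0 s)
  have hvol : ∀ s : ℝ, volume.real (A + s • K) =
      (∫ x, Real.exp (-gauge (A + s • K) x)) / n.factorial := fun s ↦ by
    rw [integral_exp_neg_gauge (hcpt s) (hcv s) (hnh s)]
    field_simp
  have hK0' : A + (0 : ℝ) • K = A := by rw [zero_smul_set ⟨0, hK0⟩, add_zero]
  have hae : ∀ᵐ x, DifferentiableAt ℝ (gauge A) x := by
    obtain ⟨L, hL⟩ := hconv.lipschitz_gauge h0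
    exact hL.ae_differentiableAt
  simp_rw [hvol]
  refine HasDerivWithinAt.div_const ?_ _
  rw [hasDerivWithinAt_Ioi_iff_Ici.symm, hasDerivWithinAt_iff_tendsto_slope' self_notMem_Ioi]
  have hslope : ∀ s : ℝ, slope (fun s : ℝ ↦ ∫ x, Real.exp (-gauge (A + s • K) x)) 0 s =
      ∫ x, slope (fun s : ℝ ↦ Real.exp (-gauge (A + s • K) x)) 0 s := fun s ↦ by
    simp_rw [slope_def_field]
    rw [integral_div, integral_sub (integrable_exp_neg_gauge (hcpt s) (hcv s) (hnh s))
      (integrable_exp_neg_gauge (hcpt 0) (hcv 0) (hnh 0))]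
  refine Filter.Tendsto.congr (fun s ↦ (hslope s).symm) ?_
  refine tendsto_integral_filter_of_dominated_convergence
    (fun x ↦ c * gauge A x * Real.exp (-gauge A x / 2)) (.of_forall fun s ↦ ?_) ?_
    (integrable_gauge_mul_exp hA hconv h0 c) ?_
  · simp_rw [slope_def_field]
    have h1 := continuous_gauge (hcv s) (hnh s)
    have h2 := continuous_gauge (hcv 0) (hnh 0)
    exact Continuous.aestronglyMeasurable (by fun_prop)
  · have hmem : Ioo 0 (1 / (2 * c)) ∈ nhdsWithin 0 (Ioi (0 : ℝ)) :=
      Ioo_mem_nhdsGT (by positivity)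
    filter_upwards [hmem] with s hs
    filter_upwards [hae] with x hx
    have hsc := hs.2
    rw [lt_div_iff₀ (by positivity)] at hsc
    have h1 := gaugeVariation_le hconv h0 hK hK0 hc.le hKA x
    have h2 := gauge_sub_gaugeVariation_le_gauge_add hconv h0 hK hK0 hx hs.1.le
    have h3 := gauge_mono (absorbent_nhds_zero h0) (subset_add_smul hK0 s) x
    have h4 := gauge_nonneg (s := A) x
    have h5 := mul_le_mul_of_nonneg_left h1 hs.1.le
    have h6 : gauge A x / 2 ≤ gauge (A + s • K) x := by nlinarith
    rw [slope_def_field, hK0', sub_zero, Real.norm_of_nonneg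
      (div_nonneg (sub_nonneg.2 (Real.exp_le_exp.2 (neg_le_neg h3))) hs.1.le), div_le_iff₀ hs.1]
    set u := gauge (A + s • K) x
    have h7 : Real.exp (-gauge A x) = Real.exp (-u) * Real.exp (u - gauge A x) := by
      rw [← Real.exp_add]; ring_nf
    have h8 := Real.add_one_le_exp (u - gauge A x)
    calc Real.exp (-u) - Real.exp (-gauge A x) = Real.exp (-u) * (1 - Real.exp (u - gauge A x)) := by
          rw [h7]; ring
      _ ≤ Real.exp (-u) * (s * (c * gauge A x)) := by gcongr; linarith
      _ ≤ Real.exp (-gauge A x / 2) * (s * (c * gauge A x)) := by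
        have := hs.1
        gcongr
        linarith
      _ = _ := by ring
  · filter_upwards [hae] with x hx
    have h1 := (hasDerivWithinAt_gauge_add_smul hA.isClosed hconv h0 hK hK0 hx).neg.exp
    rw [hasDerivWithinAt_iff_tendsto_slope' self_notMem_Ioi] at h1
    simpa [hK0'] using h1

/-- If `A` is the inner parallel body of `B` at distance `δ`, then to first order the volume of
`(1 - s/δ) A + (s/δ) B` grows at most as fast as that of `A + sK`. -/
lemma volume_combo_le (hA : IsCompact A) (hconv : Convex ℝ A)
    (h0 : A ∈ nhds 0) (hK : IsCompact K) (hK0 : 0 ∈ K)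
    {B : Set (EuclideanSpace ℝ (Fin n))} (hB : IsCompact B) (hBconv : Convex ℝ B) {δ : ℝ}
    (hδ : 0 < δ) (hAB : A = {x | ∀ y ∈ K, x + δ • y ∈ B}) :
    ∀ᶠ s in nhdsWithin 0 (Ioi (0 : ℝ)), volume.real ((1 - s / δ) • A + (s / δ) • B) ≤
      (∫ x, Real.exp (-(gauge A x - s * gaugeVariation A K x))) / n.factorial := by
  have hae : ∀ᵐ x, DifferentiableAt ℝ (gauge A) x := by
    obtain ⟨L, hL⟩ := hconv.lipschitz_gauge h0
    exact hL.ae_differentiableAt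
  have hABs : A ⊆ B := fun a ha ↦ by
    rw [hAB] at ha
    simpa using ha 0 hK0
  filter_upwards [Ioo_mem_nhdsGT hδ, (hasDerivAt_integral_exp_gaugeVariation hA hconv h0 hK
    hK0).1.filter_mono nhdsWithin_le_nhds] with s hs hint
  have hs0 := hs.1
  have hr1 : s / δ ≤ 1 := (div_le_one hδ).2 hs.2.le
  have hr0 : 0 ≤ s / δ := by positivity
  have hnh : (1 - s / δ) • A + (s / δ) • B ∈ nhds 0 := by
    refine Filter.mem_of_superset h0 fun a ha ↦ ?_
    refine ⟨(1 - s / δ) • a, smul_mem_smul_set ha, (s / δ) • a, smul_mem_smul_set (hABs ha), ?_⟩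
    simp only
    rw [← add_smul, sub_add_cancel, one_smul]
  have hcv : Convex ℝ ((1 - s / δ) • A + (s / δ) • B) := (hconv.smul _).add (hBconv.smul _)
  have hcpt : IsCompact ((1 - s / δ) • A + (s / δ) • B) := (hA.smul _).add (hB.smul _)
  rw [le_div_iff₀ (by positivity), mul_comm, ← integral_exp_neg_gauge hcpt hcv hnh]
  refine integral_mono_ae (integrable_exp_neg_gauge hcpt hcv hnh) hint ?_
  filter_upwards [hae] with x hx
  refine Real.exp_le_exp.2 (neg_le_neg (gauge_sub_gaugeVariation_le hnh hK hK0 hx hs.1.le ?_))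
  intro hx0
  rintro _ ⟨_, ⟨a, ha, rfl⟩, _, ⟨b, hb, rfl⟩, rfl⟩
  obtain ⟨k', -, h1, h2⟩ := exists_supportFun_eq hK hK0 (fderiv ℝ (gauge A) x)
  obtain ⟨k, hk, h3⟩ := exists_fderiv_gauge_apply_le hconv h0 hK hBconv hAB hx hx0
  rw [h1]
  simp only [map_add, map_smul, smul_eq_mul]
  have h4 := (fderiv_gauge_apply_le hconv h0 hx a).trans (gauge_le_one_of_mem ha)
  calc (1 - s / δ) * fderiv ℝ (gauge A) x a + s / δ * fderiv ℝ (gauge A) x b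
      ≤ (1 - s / δ) * 1 + s / δ * (1 + δ * fderiv ℝ (gauge A) x k') := by
        have := sub_nonneg.2 hr1
        gcongr
        refine (h3 b hb).trans ?_
        have := h2 k hk
        gcongr
    _ = _ := by field_simp; ring

end VolumeVariation

section Translation

variable {n : ℕ} {A K : Set (EuclideanSpace ℝ (Fin n))}

lemma volumeReal_singleton_add (v : EuclideanSpace ℝ (Fin n))
    (S : Set (EuclideanSpace ℝ (Fin n))) : volume.real ({v} + S) = volume.real S := by
  rw [singleton_add, image_add_left, measureReal_def, measure_preimage_add, measureReal_def]

lemma mem_singleton_neg_add {v x : EuclideanSpace ℝ (Fin n)}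
    {S : Set (EuclideanSpace ℝ (Fin n))} : x ∈ {-v} + S ↔ v + x ∈ S := by
  simp [singleton_add]

/-- The anisotropic Minkowski content of a convex body exists, and bounds the growth of the volume
along the segment from an inner parallel body `A` to the outer body `B`. -/
theorem exists_hasDerivWithinAt_volume_add_smul (hA : IsCompact A) (hconv : Convex ℝ A)
    (hint : (interior A).Nonempty) (hK : IsCompact K) (hKconv : Convex ℝ K) (hKne : K.Nonempty) :
    ∃ P, HasDerivWithinAt (fun s : ℝ ↦ volume.real (A + s • K)) P (Ici 0) 0 ∧
      ∀ (B : Set (EuclideanSpace ℝ (Fin n))) (δ : ℝ), IsCompact B → Convex ℝ B → 0 < δ →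
        A = {x | ∀ y ∈ K, x + δ • y ∈ B} → ∃ Ψ : ℝ → ℝ, HasDerivAt Ψ P 0 ∧
          Ψ 0 = volume.real A ∧ ∀ᶠ s in nhdsWithin 0 (Ioi (0 : ℝ)),
            volume.real ((1 - s / δ) • A + (s / δ) • B) ≤ Ψ s := by
  obtain ⟨a, ha⟩ := hint
  obtain ⟨k, hk⟩ := hKne
  have hA' : IsCompact ({-a} + A) := isCompact_singleton.add hA
  have hconv' : Convex ℝ ({-a} + A) := (convex_singleton _).add hconv
  have h0 : {-a} + A ∈ nhds 0 := by
    have : (fun x ↦ a + x) ⁻¹' A ∈ nhds 0 :=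
      ContinuousAt.preimage_mem_nhds (by fun_prop) (by simpa using mem_interior_iff_mem_nhds.1 ha)
    filter_upwards [this] with x hx
    exact mem_singleton_neg_add.2 hx
  have hK' : IsCompact ({-k} + K) := isCompact_singleton.add hK
  have hKconv' : Convex ℝ ({-k} + K) := (convex_singleton _).add hKconv
  have hK0 : 0 ∈ {-k} + K := mem_singleton_neg_add.2 (by simpa)
  refine ⟨_, (hasDerivWithinAt_volume_add_smul hA' hconv' h0 hK' hKconv' hK0).congr_of_mem
    (fun s _ ↦ ?_) self_mem_Ici, fun B δ hB hBconv hδ hAB ↦ ⟨_,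
      (hasDerivAt_integral_exp_gaugeVariation hA' hconv' h0 hK' hK0).2.div_const n.factorial, ?_, ?_⟩⟩
  · rw [smul_add, smul_set_singleton, add_add_add_comm, singleton_add_singleton,
      volumeReal_singleton_add]
  · simp only [zero_mul, sub_zero]
    rw [integral_exp_neg_gauge hA' hconv' h0, volumeReal_singleton_add]
    field_simp
  · have hAB' : {-a} + A = {x | ∀ y ∈ {-k} + K, x + δ • y ∈ {-(a + δ • k)} + B} := by
      ext x
      rw [mem_singleton_neg_add, hAB]
      simp only [mem_ofPred_eq, mem_singleton_neg_add]
      refine ⟨fun h y hy ↦ ?_, fun h y hy ↦ ?_⟩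
      · convert h _ hy using 1
        module
      · convert h (y - k) (by simpa) using 1
        module
    filter_upwards [volume_combo_le hA' hconv' h0 hK' hK0 (isCompact_singleton.add hB)
      ((convex_singleton _).add hBconv) hδ hAB'] with s hs
    refine le_trans (le_of_eq ?_) hs
    rw [smul_add, smul_add, smul_set_singleton, smul_set_singleton, add_add_add_comm,
      singleton_add_singleton, volumeReal_singleton_add]

end Translation

section Isoperimetric

lemma HasDerivWithinAt.le_of_eventually_le {f g : ℝ → ℝ} {f' g' a : ℝ}
    (hf : HasDerivWithinAt f f' (Ioi a) a) (hg : HasDerivWithinAt g g' (Ioi a) a)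
    (ha : f a = g a) (h : ∀ᶠ s in nhdsWithin a (Ioi a), f s ≤ g s) : f' ≤ g' := by
  rw [hasDerivWithinAt_iff_tendsto_slope' self_notMem_Ioi] at hf hg
  refine le_of_tendsto_of_tendsto hf hg ?_
  filter_upwards [h, self_mem_nhdsWithin] with s hs hsa
  rw [slope_def_field, slope_def_field, ha]
  have : 0 < s - a := sub_pos.2 hsa
  gcongr

lemma hasDerivWithinAt_const_add_mul (a b : ℝ) :
    HasDerivWithinAt (fun s : ℝ ↦ a + s * b) b (Ioi 0) 0 := by
  simpa using (((hasDerivAt_id (0 : ℝ)).mul_const b).const_add a).hasDerivWithinAt (s := Ioi 0)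

variable {n : ℕ} {A K : Set (EuclideanSpace ℝ (Fin n))}

lemma volumeReal_pos (hA : IsCompact A) (hint : (interior A).Nonempty) : 0 < volume.real A :=
  ENNReal.toReal_pos (Measure.measure_pos_of_nonempty_interior _ hint).ne' hA.measure_lt_top.ne

lemma volumeReal_smul_rpow (hn : n ≠ 0) {c : ℝ} (hc : 0 ≤ c)
    (A : Set (EuclideanSpace ℝ (Fin n))) :
    volume.real (c • A) ^ (1 / n : ℝ) = c * volume.real A ^ (1 / n : ℝ) := by
  rw [volumeReal_smul hc, Real.mul_rpow (by positivity) (by positivity), one_div,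
    Real.pow_rpow_inv_natCast hc hn]

lemma volumeReal_add_smul_rpow_ge (hn : n ≠ 0) (hA : IsCompact A) (hA0 : 0 < volume.real A)
    (hK : IsCompact K) (hK0 : 0 < volume.real K) {a b : ℝ} (ha : 0 < a) (hb : 0 < b) :
    a * volume.real A ^ (1 / n : ℝ) + b * volume.real K ^ (1 / n : ℝ) ≤
      volume.real (a • A + b • K) ^ (1 / n : ℝ) := by
  have h := brunnMinkowski hn (hA.smul a) (hK.smul b)
    (by rw [volumeReal_smul ha.le]; positivity) (by rw [volumeReal_smul hb.le]; positivity)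
  rwa [volumeReal_smul_rpow hn ha.le, volumeReal_smul_rpow hn hb.le] at h

/-- The derivative of `t ↦ V(A + tK) ^ (1 / n)` at `0`. -/
lemma hasDerivWithinAt_volume_rpow (hA0 : 0 < volume.real A) (hKne : K.Nonempty) {P : ℝ}
    (hP : HasDerivWithinAt (fun s : ℝ ↦ volume.real (A + s • K)) P (Ici 0) 0) :
    HasDerivWithinAt (fun s : ℝ ↦ volume.real (A + s • K) ^ (1 / n : ℝ))
      (P * (1 / n) * volume.real A ^ (1 / n - 1 : ℝ)) (Ioi 0) 0 := by
  have h := (hP.mono Ioi_subset_Ici_self).rpow_const (p := (1 / n : ℝ))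
    (Or.inl (by simpa [zero_smul_set hKne] using hA0.ne'))
  simpa [zero_smul_set hKne] using h

lemma pos_of_hasDerivWithinAt_volume (hn : n ≠ 0) (hA : IsCompact A) (hA0 : 0 < volume.real A)
    (hK : IsCompact K) (hK0 : 0 < volume.real K) (hKne : K.Nonempty) {P : ℝ}
    (hP : HasDerivWithinAt (fun s : ℝ ↦ volume.real (A + s • K)) P (Ici 0) 0) : 0 < P := by
  have h1 : HasDerivWithinAt (fun s : ℝ ↦ volume.real A ^ (1 / n : ℝ) +
      s * volume.real K ^ (1 / n : ℝ)) (volume.real K ^ (1 / n : ℝ)) (Ioi 0) 0 :=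
    hasDerivWithinAt_const_add_mul _ _
  have h2 := h1.le_of_eventually_le (hasDerivWithinAt_volume_rpow hA0 hKne hP)
    (by simp [zero_smul_set hKne]) (by
      filter_upwards [self_mem_nhdsWithin] with s hs
      simpa using volumeReal_add_smul_rpow_ge hn hA hA0 hK hK0 one_pos hs)
  have h3 : 0 < P * (1 / n) * volume.real A ^ (1 / n - 1 : ℝ) := by
    refine lt_of_lt_of_le ?_ h2
    positivity
  have h4 : 0 < (1 / n : ℝ) := by positivity
  rw [mul_assoc] at h3
  exact pos_of_mul_pos_left h3 (by positivity)

lemma hasDerivWithinAt_volume_le (hn : n ≠ 0) {B : Set (EuclideanSpace ℝ (Fin n))}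
    (hA : IsCompact A) (hA0 : 0 < volume.real A)
    (hB : IsCompact B) (hBconv : Convex ℝ B) (hB0 : 0 < volume.real B)
    (hK : IsCompact K) (hK0 : 0 < volume.real K) (hKne : K.Nonempty) {δ P : ℝ} (hδ : 0 < δ)
    (hAB : A = {x | ∀ y ∈ K, x + δ • y ∈ B})
    (hP : HasDerivWithinAt (fun s : ℝ ↦ volume.real (B + s • K)) P (Ici 0) 0) :
    P * (1 / n) * volume.real B ^ (1 / n - 1 : ℝ) ≤
      (volume.real B ^ (1 / n : ℝ) - volume.real A ^ (1 / n : ℝ)) / δ := by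
  set α := volume.real A ^ (1 / n : ℝ)
  set β := volume.real B ^ (1 / n : ℝ) with hβ
  have h1 : HasDerivWithinAt (fun s : ℝ ↦ β + s * ((β - α) / δ)) ((β - α) / δ) (Ioi 0) 0 :=
    hasDerivWithinAt_const_add_mul _ _
  refine (hasDerivWithinAt_volume_rpow hB0 hKne hP).le_of_eventually_le h1
    (by simp [zero_smul_set hKne, hβ]) ?_
  filter_upwards [self_mem_nhdsWithin] with s hs
  rw [mem_Ioi] at hs
  have hsub : δ • (B + s • K) + s • A ⊆ (δ + s) • B := by
    rintro _ ⟨_, ⟨_, ⟨b, hb, _, ⟨k, hk, rfl⟩, rfl⟩, rfl⟩, _, ⟨a, ha, rfl⟩, rfl⟩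
    rw [hBconv.add_smul hδ.le hs.le]
    rw [hAB] at ha
    refine ⟨δ • b, smul_mem_smul_set hb, s • (a + δ • k), smul_mem_smul_set (ha k hk), ?_⟩
    simp only
    module
  have hBK : IsCompact (B + s • K) := hB.add (hK.smul s)
  have hBK0 : 0 < volume.real (B + s • K) := by
    have h := volumeReal_add_smul_rpow_ge hn hB hB0 hK hK0 one_pos hs
    rw [one_smul] at h
    refine measureReal_nonneg.lt_of_ne fun h0 ↦ ?_
    rw [← h0, Real.zero_rpow (by positivity)] at h
    have : 0 < β := by positivity
    have : 0 < volume.real K ^ (1 / n : ℝ) := by positivity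
    nlinarith
  have h2 := volumeReal_add_smul_rpow_ge hn hBK hBK0 hA hA0 hδ hs
  have h3 : volume.real (δ • (B + s • K) + s • A) ^ (1 / n : ℝ) ≤ (δ + s) * β := by
    rw [hβ, ← volumeReal_smul_rpow hn (by positivity)]
    gcongr
    exact (hB.smul _).measure_lt_top.ne
  have h4 : β + s * ((β - α) / δ) = ((δ + s) * β - s * α) / δ := by field_simp; ring
  rw [h4, le_div_iff₀ hδ]
  linarith

lemma le_hasDerivWithinAt_volume (hn : n ≠ 0) {B : Set (EuclideanSpace ℝ (Fin n))}
    (hA : IsCompact A) (hA0 : 0 < volume.real A) (hB : IsCompact B) (hB0 : 0 < volume.real B)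
    {δ P : ℝ} (hδ : 0 < δ) {Ψ : ℝ → ℝ} (hΨ : HasDerivAt Ψ P 0) (hΨ0 : Ψ 0 = volume.real A)
    (h : ∀ᶠ s in nhdsWithin 0 (Ioi (0 : ℝ)),
      volume.real ((1 - s / δ) • A + (s / δ) • B) ≤ Ψ s) :
    (volume.real B ^ (1 / n : ℝ) - volume.real A ^ (1 / n : ℝ)) / δ ≤
      P * (1 / n) * volume.real A ^ (1 / n - 1 : ℝ) := by
  set α := volume.real A ^ (1 / n : ℝ) with hα
  set β := volume.real B ^ (1 / n : ℝ)
  have h1 : HasDerivWithinAt (fun s : ℝ ↦ α + s * ((β - α) / δ)) ((β - α) / δ) (Ioi 0) 0 :=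
    hasDerivWithinAt_const_add_mul _ _
  have h2 := (hΨ.rpow_const (p := (1 / n : ℝ)) (Or.inl (hΨ0 ▸ hA0.ne'))).hasDerivWithinAt
    (s := Ioi 0)
  rw [hΨ0] at h2
  refine h1.le_of_eventually_le h2 (by simp [hΨ0, hα]) ?_
  filter_upwards [h, Ioo_mem_nhdsGT hδ] with s hs hsδ
  have h3 := volumeReal_add_smul_rpow_ge hn hA hA0 hB hB0 (sub_pos.2 ((div_lt_one hδ).2 hsδ.2))
    (div_pos hsδ.1 hδ)
  calc α + s * ((β - α) / δ) = (1 - s / δ) * α + s / δ * β := by ring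
    _ ≤ _ := h3
    _ ≤ _ := by gcongr

lemma aniPer_eq {P : ℝ}
    (hP : HasDerivWithinAt (fun s : ℝ ↦ volume.real (A + s • K)) P (Ici 0) 0) : aniPer A K = P :=
  hP.derivWithin (uniqueDiffWithinAt_Ici 0)

/-- The isoperimetric quotient of an inner parallel body does not exceed that of the body. -/
theorem isoperimetricQuotient_le (hn : 2 ≤ n) {B : Set (EuclideanSpace ℝ (Fin n))}
    (hA : IsCompact A) (hAconv : Convex ℝ A) (hAint : (interior A).Nonempty)
    (hB : IsCompact B) (hBconv : Convex ℝ B) (hBint : (interior B).Nonempty)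
    (hK : IsCompact K) (hKconv : Convex ℝ K) (hKint : (interior K).Nonempty)
    {δ : ℝ} (hδ : 0 < δ) (hAB : A = {x | ∀ y ∈ K, x + δ • y ∈ B}) :
    volume.real A / aniPer A K ^ ((n : ℝ) / (n - 1)) ≤
      volume.real B / aniPer B K ^ ((n : ℝ) / (n - 1)) := by
  have hn0 : n ≠ 0 := by omega
  have hKne := hKint.mono interior_subset
  have hA0 := volumeReal_pos hA hAint
  have hB0 := volumeReal_pos hB hBint
  have hK0 := volumeReal_pos hK hKint
  obtain ⟨P, hP, hPB⟩ := exists_hasDerivWithinAt_volume_add_smul hA hAconv hAint hK hKconv hKne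
  obtain ⟨Q, hQ, -⟩ := exists_hasDerivWithinAt_volume_add_smul hB hBconv hBint hK hKconv hKne
  obtain ⟨Ψ, hΨ, hΨ0, hΨle⟩ := hPB B δ hB hBconv hδ hAB
  have hP0 := pos_of_hasDerivWithinAt_volume hn0 hA hA0 hK hK0 hKne hP
  have hQ0 := pos_of_hasDerivWithinAt_volume hn0 hB hB0 hK hK0 hKne hQ
  have hmain := (hasDerivWithinAt_volume_le hn0 hA hA0 hB hBconv hB0 hK hK0 hKne hδ hAB hQ).trans
    (le_hasDerivWithinAt_volume hn0 hA hA0 hB hB0 hδ hΨ hΨ0 hΨle)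
  rw [aniPer_eq hP, aniPer_eq hQ]
  have hn1 : (0 : ℝ) < n - 1 := by
    have : (2 : ℝ) ≤ n := by exact_mod_cast hn
    linarith
  have hn0' : (0 : ℝ) < n := by linarith
  have key : Q * volume.real B ^ (1 / n - 1 : ℝ) ≤ P * volume.real A ^ (1 / n - 1 : ℝ) := by
    refine le_of_mul_le_mul_left ?_ (show (0 : ℝ) < 1 / n by positivity)
    linarith
  have hpow : ∀ {V R : ℝ}, 0 < V → 0 < R →
      (R * V ^ (1 / n - 1 : ℝ)) ^ ((n : ℝ) / (n - 1)) = (V / R ^ ((n : ℝ) / (n - 1)))⁻¹ := by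
    intro V R hV hR
    rw [Real.mul_rpow hR.le (by positivity), ← Real.rpow_mul hV.le, inv_div,
      div_eq_mul_inv _ V, ← Real.rpow_neg_one V]
    congr 2
    field_simp
    ring
  have h := Real.rpow_le_rpow (by positivity) key (show 0 ≤ (n : ℝ) / (n - 1) by positivity)
  rw [hpow hB0 hQ0, hpow hA0 hP0] at h
  exact (inv_le_inv₀ (by positivity) (by positivity)).1 h

end Isoperimetric

section InnerPar

variable {n : ℕ} {Ω K : Set (EuclideanSpace ℝ (Fin n))}

lemma isCompact_innerPar (hΩ : IsCompact Ω) (hKne : K.Nonempty) (l : ℝ) :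
    IsCompact (innerPar Ω K l) := by
  obtain ⟨k, hk⟩ := hKne
  have h1 : IsCompact ((fun x ↦ x - l • k) '' Ω) := hΩ.image (by fun_prop)
  refine h1.of_isClosed_subset ?_ fun x hx ↦ ⟨x + l • k, hx k hk, by simp⟩
  have : innerPar Ω K l = ⋂ y ∈ K, (fun x ↦ x + l • y) ⁻¹' Ω := by
    ext x
    simp [innerPar]
  rw [this]
  exact isClosed_biInter fun y _ ↦ hΩ.isClosed.preimage (by fun_prop)

lemma convex_innerPar (hΩ : Convex ℝ Ω) (l : ℝ) : Convex ℝ (innerPar Ω K l) := by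
  intro x hx y hy a b ha hb hab k hk
  convert hΩ (hx k hk) (hy k hk) ha hb hab using 1
  rw [smul_add, smul_add, add_add_add_comm, ← add_smul, hab, one_smul]

lemma interior_innerPar_nonempty (hΩ : Convex ℝ Ω) (hΩint : (interior Ω).Nonempty) {l : ℝ}
    (hl : 0 ≤ l) (h : l < inrad Ω K) : (interior (innerPar Ω K l)).Nonempty := by
  have hne : {l : ℝ | 0 ≤ l ∧ ∃ x, ∀ y ∈ K, x + l • y ∈ Ω}.Nonempty := by
    by_contra hcon
    rw [not_nonempty_iff_eq_empty] at hcon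
    rw [inrad, hcon, Real.sSup_empty] at h
    linarith
  obtain ⟨r, ⟨hr, x, hx⟩, hlr⟩ := exists_lt_of_lt_csSup hne h
  have hr0 : 0 < r := hl.trans_lt hlr
  have ht : 0 < 1 - l / r := sub_pos.2 ((div_lt_one hr0).2 hlr)
  have hsub : (fun w ↦ (l / r) • x + w) '' ((1 - l / r) • interior Ω) ⊆ innerPar Ω K l := by
    rintro _ ⟨_, ⟨w, hw, rfl⟩, rfl⟩ k hk
    convert hΩ (interior_subset hw) (hx k hk) ht.le (by positivity) (sub_add_cancel 1 (l / r))
      using 1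
    have : l • k = (l / r * r) • k := by rw [div_mul_cancel₀ _ hr0.ne']
    simp only
    rw [this]
    module
  refine Nonempty.mono (interior_maximal hsub ?_) ((hΩint.smul_set).image _)
  exact isOpenMap_add_left _ _ (isOpen_interior.smul₀ ht.ne')

lemma innerPar_eq_innerPar_innerPar (hK : Convex ℝ K) {l m : ℝ} (hl : 0 ≤ l) (hlm : l < m) :
    innerPar Ω K m = innerPar (innerPar Ω K l) K (m - l) := by
  have hm : 0 < m := hl.trans_lt hlm
  ext x
  refine ⟨fun h y hy z hz ↦ ?_, fun h y hy ↦ ?_⟩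
  · convert h _ (hK hy hz (a := (m - l) / m) (b := l / m)
      (div_nonneg (sub_nonneg.2 hlm.le) hm.le) (by positivity) (by field_simp; ring)) using 1
    rw [smul_add, smul_smul, smul_smul, mul_div_cancel₀ _ hm.ne', mul_div_cancel₀ _ hm.ne',
      add_assoc]
  · convert h y hy y hy using 1
    module

end InnerPar

/-- anisotropic monotonicity of the isoperimetric quotient:
`Q(λ) = V_n(Ω∼λK) / Per_K(Ω∼λK)^{n/(n-1)}` is non-increasing on `[0, r)`. -/
theorem stmt17 {n : ℕ} (hn : 2 ≤ n) (Ω K : Set (EuclideanSpace ℝ (Fin n)))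
    (hΩc : IsCompact Ω) (hΩconv : Convex ℝ Ω) (hΩint : (interior Ω).Nonempty)
    (hKc : IsCompact K) (hKconv : Convex ℝ K) (hKint : (interior K).Nonempty) :
    ∀ l m : ℝ, 0 ≤ l → l ≤ m → m < inrad Ω K →
      (volume (innerPar Ω K m)).toReal / aniPer (innerPar Ω K m) K ^ ((n : ℝ) / ((n : ℝ) - 1))
        ≤ (volume (innerPar Ω K l)).toReal / aniPer (innerPar Ω K l) K ^ ((n : ℝ) / ((n : ℝ) - 1)) := by
  intro l m hl hlm hm
  rcases hlm.eq_or_lt with rfl | hlm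
  · rfl
  have hKne := hKint.mono interior_subset
  exact isoperimetricQuotient_le hn (isCompact_innerPar hΩc hKne m) (convex_innerPar hΩconv m)
    (interior_innerPar_nonempty hΩconv hΩint (hl.trans hlm.le) hm)
    (isCompact_innerPar hΩc hKne l) (convex_innerPar hΩconv l)
    (interior_innerPar_nonempty hΩconv hΩint hl (hlm.trans hm)) hKc hKconv hKint
    (sub_pos.2 hlm) (innerPar_eq_innerPar_innerPar hKconv hl hlm)
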